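/- Let v, H : ℝ × U → ℝ³ be smooth and satisfy the ideal MHD induction equation D_t H = (H·∇)v pointwise on ℝ × U. Then the matrix curl of the magnetic field satisfies the transport identity D_t(curl H) = (H·∇)(curl v) + (∇v)(∇H) − (∇H)(∇v) + (∇v)ᵀ(∇H)ᵀ − (∇H)ᵀ(∇v)ᵀ pointwise on ℝ × U. -/

import Mathlib

/-- Spatial partial derivative `∂_j f` of a scalar function on `ℝ × ℝ³`. -/
noncomputable def pdx (j : Fin 3) (f : ℝ × (Fin 3 → ℝ) → ℝ) (p : ℝ × (Fin 3 → ℝ)) : ℝ :=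
  fderiv ℝ f p (0, Pi.single j 1)

/-- Time partial derivative `∂_t f` of a scalar function on `ℝ × ℝ³`. -/
noncomputable def pdt (f : ℝ × (Fin 3 → ℝ) → ℝ) (p : ℝ × (Fin 3 → ℝ)) : ℝ :=
  fderiv ℝ f p (1, 0)

/-- Material derivative `D_t f = ∂_t f + vᵏ ∂_k f` along the velocity field `v`. -/
noncomputable def Dt (v : ℝ × (Fin 3 → ℝ) → Fin 3 → ℝ) (f : ℝ × (Fin 3 → ℝ) → ℝ)
    (p : ℝ × (Fin 3 → ℝ)) : ℝ :=
  pdt f p + ∑ k : Fin 3, v p k * pdx k f p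

theorem fderiv_fderiv_apply_comm {E F : Type*} [NormedAddCommGroup E] [NormedSpace ℝ E]
    [NormedAddCommGroup F] [NormedSpace ℝ F] {f : E → F} {p : E}
    (hf : ContDiffAt ℝ 2 f p) (a b : E) :
    fderiv ℝ (fun q => fderiv ℝ f q a) p b = fderiv ℝ (fun q => fderiv ℝ f q b) p a := by
  have hd : DifferentiableAt ℝ (fderiv ℝ f) p :=
    (hf.fderiv_right (m := 1) (by norm_num)).differentiableAt (by norm_num)
  have hs : IsSymmSndFDerivAt ℝ f p := hf.isSymmSndFDerivAt (by simp)
  rw [fderiv_clm_apply hd (differentiableAt_const a),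
    fderiv_clm_apply hd (differentiableAt_const b)]
  simpa using hs.eq b a

theorem differentiableAt_fderiv_apply {E F : Type*} [NormedAddCommGroup E] [NormedSpace ℝ E]
    [NormedAddCommGroup F] [NormedSpace ℝ F] {f : E → F} {p : E}
    (hf : ContDiffAt ℝ 2 f p) (a : E) : DifferentiableAt ℝ (fun q => fderiv ℝ f q a) p :=
  ((hf.fderiv_right (m := 1) (by norm_num)).differentiableAt (by norm_num)).clm_apply
    (differentiableAt_const a)

theorem pdx_sub {f g : ℝ × (Fin 3 → ℝ) → ℝ} {p : ℝ × (Fin 3 → ℝ)} (j : Fin 3)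
    (hf : DifferentiableAt ℝ f p) (hg : DifferentiableAt ℝ g p) :
    pdx j (fun q => f q - g q) p = pdx j f p - pdx j g p := by
  simp [pdx, fderiv_fun_sub hf hg]

theorem Dt_sub (v : ℝ × (Fin 3 → ℝ) → Fin 3 → ℝ) {f g : ℝ × (Fin 3 → ℝ) → ℝ}
    {p : ℝ × (Fin 3 → ℝ)} (hf : DifferentiableAt ℝ f p) (hg : DifferentiableAt ℝ g p) :
    Dt v (fun q => f q - g q) p = Dt v f p - Dt v g p := by
  simp only [Dt, pdx_sub _ hf hg, pdt, fderiv_fun_sub hf hg, sub_apply, mul_sub,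
    Finset.sum_sub_distrib]
  ring

/-- Differentiating the directional derivative `(w·∇)f`. -/
theorem pdx_sum_mul_pdx {w : ℝ × (Fin 3 → ℝ) → Fin 3 → ℝ} {f : ℝ × (Fin 3 → ℝ) → ℝ}
    {p : ℝ × (Fin 3 → ℝ)} (hw : DifferentiableAt ℝ w p) (hf : ContDiffAt ℝ 2 f p) (j : Fin 3) :
    pdx j (fun q => ∑ k : Fin 3, w q k * pdx k f q) p
      = ∑ k : Fin 3, w p k * pdx k (pdx j f) p
        + ∑ k : Fin 3, pdx j (fun r => w r k) p * pdx k f p := by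
  have hwk (k : Fin 3) : DifferentiableAt ℝ (fun r => w r k) p := differentiableAt_pi.1 hw k
  have hd (k : Fin 3) : DifferentiableAt ℝ (pdx k f) p := differentiableAt_fderiv_apply hf _
  have hcomm (k : Fin 3) : pdx k (pdx j f) p = pdx j (pdx k f) p :=
    fderiv_fderiv_apply_comm hf _ _
  rw [← Finset.sum_add_distrib]
  simp only [hcomm]
  rw [pdx, fderiv_fun_sum fun k _ => (hwk k).fun_mul (hd k), sum_apply]
  refine Finset.sum_congr rfl fun k _ => ?_
  rw [fderiv_fun_mul (hwk k) (hd k)]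
  simp only [add_apply, smul_apply, smul_eq_mul, pdx]
  ring

/-- The commutator of a spatial derivative with the material derivative. -/
theorem pdx_Dt {v : ℝ × (Fin 3 → ℝ) → Fin 3 → ℝ} {f : ℝ × (Fin 3 → ℝ) → ℝ}
    {p : ℝ × (Fin 3 → ℝ)} (hv : DifferentiableAt ℝ v p) (hf : ContDiffAt ℝ 2 f p) (j : Fin 3) :
    pdx j (Dt v f) p
      = Dt v (pdx j f) p + ∑ k : Fin 3, pdx j (fun r => v r k) p * pdx k f p := by
  have ht : DifferentiableAt ℝ (pdt f) p := differentiableAt_fderiv_apply hf _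
  have hs : DifferentiableAt ℝ (fun q => ∑ k : Fin 3, v q k * pdx k f q) p :=
    DifferentiableAt.fun_sum fun k _ =>
      (differentiableAt_pi.1 hv k).mul (differentiableAt_fderiv_apply hf _)
  have hadd : pdx j (Dt v f) p
      = pdx j (pdt f) p + pdx j (fun q => ∑ k : Fin 3, v q k * pdx k f q) p := by
    change fderiv ℝ (fun q => pdt f q + ∑ k : Fin 3, v q k * pdx k f q) p _ = _
    rw [fderiv_fun_add ht hs]
    rfl
  have hcomm : pdx j (pdt f) p = pdt (pdx j f) p := fderiv_fderiv_apply_comm hf _ _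
  rw [hadd, hcomm, pdx_sum_mul_pdx hv hf, Dt, add_assoc]

/-- If D_t H = (H·∇)v, then the matrix curl of H satisfies
D_t(curl H) = (H·∇)(curl v) + (∇v)(∇H) − (∇H)(∇v) + (∇v)ᵀ(∇H)ᵀ − (∇H)ᵀ(∇v)ᵀ,
componentwise. -/
theorem Dt_curl_H_transport (U : Set (Fin 3 → ℝ)) (hU : IsOpen U)
    (v H : ℝ × (Fin 3 → ℝ) → Fin 3 → ℝ)
    (hv : ContDiffOn ℝ (⊤ : ℕ∞) v (Set.univ ×ˢ U))
    (hH : ContDiffOn ℝ (⊤ : ℕ∞) H (Set.univ ×ˢ U))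
    (hind : ∀ t : ℝ, ∀ x ∈ U, ∀ i : Fin 3,
      Dt v (fun r => H r i) (t, x)
        = ∑ k : Fin 3, H (t, x) k * pdx k (fun r => v r i) (t, x)) :
    ∀ t : ℝ, ∀ x ∈ U, ∀ i j : Fin 3,
      Dt v (fun q => pdx j (fun r => H r i) q - pdx i (fun r => H r j) q) (t, x)
      = (∑ k : Fin 3, H (t, x) k *
            pdx k (fun q => pdx j (fun r => v r i) q - pdx i (fun r => v r j) q) (t, x))
        + (∑ k : Fin 3, pdx k (fun r => v r i) (t, x) * pdx j (fun r => H r k) (t, x))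
        - (∑ k : Fin 3, pdx k (fun r => H r i) (t, x) * pdx j (fun r => v r k) (t, x))
        + (∑ k : Fin 3, pdx i (fun r => v r k) (t, x) * pdx k (fun r => H r j) (t, x))
        - ∑ k : Fin 3, pdx i (fun r => H r k) (t, x) * pdx k (fun r => v r j) (t, x) := by
  intro t x hx i j
  have hopen : IsOpen ((Set.univ : Set ℝ) ×ˢ U) := isOpen_univ.prod hU
  have hnhds : (Set.univ : Set ℝ) ×ˢ U ∈ nhds (t, x) := hopen.mem_nhds ⟨trivial, hx⟩
  have hv2 : ContDiffAt ℝ 2 v (t, x) := (hv.contDiffAt hnhds).of_le (WithTop.coe_le_coe.2 le_top)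
  have hH2 : ContDiffAt ℝ 2 H (t, x) := (hH.contDiffAt hnhds).of_le (WithTop.coe_le_coe.2 le_top)
  have hvc (k : Fin 3) : ContDiffAt ℝ 2 (fun r => v r k) (t, x) := contDiffAt_pi.1 hv2 k
  have hHc (k : Fin 3) : ContDiffAt ℝ 2 (fun r => H r k) (t, x) := contDiffAt_pi.1 hH2 k
  have hgrad (a b : Fin 3) :
      Dt v (pdx b fun r => H r a) (t, x)
          + ∑ k : Fin 3, pdx b (fun r => v r k) (t, x) * pdx k (fun r => H r a) (t, x)
        = ∑ k : Fin 3, H (t, x) k * pdx k (pdx b fun r => v r a) (t, x)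
          + ∑ k : Fin 3, pdx b (fun r => H r k) (t, x) * pdx k (fun r => v r a) (t, x) := by
    have heq : Dt v (fun r => H r a)
        =ᶠ[nhds (t, x)] fun q => ∑ k : Fin 3, H q k * pdx k (fun r => v r a) q :=
      Filter.eventually_of_mem hnhds fun q hq => hind q.1 q.2 hq.2 a
    rw [← pdx_Dt (hv2.differentiableAt (by norm_num)) (hHc a) b,
      ← pdx_sum_mul_pdx (hH2.differentiableAt (by norm_num)) (hvc a) b, pdx, heq.fderiv_eq, pdx]
  have hdH (a b : Fin 3) : DifferentiableAt ℝ (pdx b fun r => H r a) (t, x) :=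
    differentiableAt_fderiv_apply (hHc a) _
  have hdv (a b : Fin 3) : DifferentiableAt ℝ (pdx b fun r => v r a) (t, x) :=
    differentiableAt_fderiv_apply (hvc a) _
  rw [Dt_sub v (hdH i j) (hdH j i)]
  simp only [fun k => pdx_sub k (hdv i j) (hdv j i)]
  have hij := hgrad i j
  have hji := hgrad j i
  simp only [Fin.sum_univ_three] at hij hji ⊢
  linear_combination hij - hji
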